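/- Let A be a {0,1}-valued random variable with 0 < P(A=1) < 1. Suppose that conditionally on A=a, X2 is Gaussian N(μ_a, σ_2²) with μ_0 ≠ μ_1 and σ_2 > 0, and let X3 be Gaussian N(0, σ_3²) with σ_3 > 0, independent of the pair (A, X2). Let β_2, β_3 be nonzero reals and define Y = β_2·X2 + β_3·X3. Then X3 is independent of A, yet X3 and A are NOT conditionally independent given Y: conditioning on the collider Y induces dependence between X3 and A. -/

import Mathlib

open MeasureTheory ProbabilityTheory

/-- If `g` and `f` are conditionally independent given `k`, then the conditional probability of
`f ∈ s` given `(k, g)` is a function of `k` alone. -/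
lemma measure_preimage_inter_eq_setLIntegral_of_condIndepFun
    {Ω α β γ : Type*} [MeasurableSpace Ω] [StandardBorelSpace Ω]
    [MeasurableSpace α] [StandardBorelSpace α] [Nonempty α]
    [MeasurableSpace β] [StandardBorelSpace β] [Nonempty β] [MeasurableSpace γ]
    {μ : Measure Ω} [IsFiniteMeasure μ] {f : Ω → α} {g : Ω → β} {k : Ω → γ}
    (hf : Measurable f) (hg : Measurable g) (hk : Measurable k)
    (h : CondIndepFun (MeasurableSpace.comap k inferInstance) hk.comap_le g f μ)
    {s : Set α} (hs : MeasurableSet s) {t : Set (γ × β)} (ht : MeasurableSet t) :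
    μ ((fun ω ↦ (k ω, g ω)) ⁻¹' t ∩ f ⁻¹' s)
      = ∫⁻ ω in (fun ω ↦ (k ω, g ω)) ⁻¹' t, condDistrib f k μ (k ω) s ∂μ := by
  have hkg : Measurable fun ω ↦ (k ω, g ω) := hk.prodMk hg
  have hae := (condIndepFun_iff_condDistrib_prod_ae_eq_prodMkRight hf hg hk).1 h
  have hjoint := compProd_map_condDistrib (mβ := inferInstance)
    (X := fun ω ↦ (k ω, g ω)) hf.aemeasurable (μ := μ)
  have hmeas : Measurable fun p : γ × β ↦ condDistrib f k μ p.1 s :=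
    (Kernel.measurable_coe _ hs).comp measurable_fst
  calc μ ((fun ω ↦ (k ω, g ω)) ⁻¹' t ∩ f ⁻¹' s)
      = μ.map (fun ω ↦ ((k ω, g ω), f ω)) (t ×ˢ s) := by
        rw [Measure.map_apply (hkg.prodMk hf) (ht.prod hs)]; rfl
    _ = ∫⁻ p in t, condDistrib f (fun ω ↦ (k ω, g ω)) μ p s ∂(μ.map fun ω ↦ (k ω, g ω)) := by
        rw [← hjoint, Measure.compProd_apply_prod ht hs]
    _ = ∫⁻ p in t, condDistrib f k μ p.1 s ∂(μ.map fun ω ↦ (k ω, g ω)) := by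
        refine lintegral_congr_ae (ae_restrict_of_ae ?_)
        filter_upwards [hae] with p hp
        rw [hp, Kernel.prodMkRight_apply]
    _ = _ := setLIntegral_map ht hmeas hkg

/-- If `Z` is independent of `(A, X)`, then on the event `A ∈ s` the pair `(X, Z)` has a product
law. -/
lemma map_restrict_preimage_prodMk_eq_prod_of_indepFun
    {Ω α β γ : Type*} [MeasurableSpace Ω] [MeasurableSpace α] [MeasurableSpace β]
    [MeasurableSpace γ] {μ : Measure Ω} [IsFiniteMeasure μ] {A : Ω → α} {X : Ω → β} {Z : Ω → γ}
    (hX : Measurable X) (hZ : Measurable Z)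
    (h : IndepFun Z (fun ω ↦ (A ω, X ω)) μ) {s : Set α} (hs : MeasurableSet s) :
    (μ.restrict (A ⁻¹' s)).map (fun ω ↦ (X ω, Z ω))
      = ((μ.restrict (A ⁻¹' s)).map X).prod (μ.map Z) := by
  refine (Measure.prod_eq fun t u ht hu ↦ ?_).symm
  rw [Measure.map_apply (hX.prodMk hZ) (ht.prod hu), Measure.map_apply hX ht,
    Measure.map_apply hZ hu, Measure.restrict_apply (hX ht),
    Measure.restrict_apply ((hX.prodMk hZ) (ht.prod hu))]
  have key := h.measure_inter_preimage_eq_mul u (s ×ˢ t) hu (hs.prod ht)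
  rw [show X ⁻¹' t ∩ A ⁻¹' s = (fun ω ↦ (A ω, X ω)) ⁻¹' (s ×ˢ t) by
    ext ω; simp [and_comm], mul_comm, ← key]
  congr 1
  ext ω
  simp only [Set.mem_inter_iff, Set.mem_preimage, Set.mem_prod]
  tauto

/-- A relation holding between `x` and `a * x + b * y` for almost every `(x, y)` holds between two
distinct points and a common value. -/
lemma exists_ne_of_ae_prod_affine {a b : ℝ} (hb : b ≠ 0) {S : ℝ → ℝ → Prop}
    (h : ∀ᵐ p : ℝ × ℝ, S p.1 (a * p.1 + b * p.2)) :
    ∃ x x' u, x ≠ x' ∧ S x u ∧ S x' u := by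
  have hx : ∀ᵐ x : ℝ, ∀ᵐ u : ℝ, S x u := by
    filter_upwards [Measure.ae_ae_of_ae_prod h] with x hx
    have hq : Measure.QuasiMeasurePreserving (fun u : ℝ ↦ b⁻¹ • (u - a * x)) volume volume :=
      (Measure.quasiMeasurePreserving_smul volume (inv_ne_zero hb)).comp
        (measurePreserving_sub_right volume (a * x)).quasiMeasurePreserving
    filter_upwards [hq.ae hx] with u hu
    convert hu using 1
    simp [mul_inv_cancel_left₀ hb]
  obtain ⟨x, hx₁⟩ := hx.exists
  obtain ⟨x', hx₂, hne⟩ := (hx.and (Measure.ae_ne volume x)).exists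
  obtain ⟨u, hu₁, hu₂⟩ := (hx₁.and hx₂).exists
  exact ⟨x, x', u, hne.symm, hu₁, hu₂⟩

/-- The likelihood ratio of two Gaussian densities with the same variance and different means is
injective. -/
lemma eq_of_gaussianPDFReal_mul_eq {m₀ m₁ : ℝ} (hm : m₀ ≠ m₁) {v : NNReal} (hv : v ≠ 0) {x y : ℝ}
    (h : gaussianPDFReal m₁ v x * gaussianPDFReal m₀ v y
      = gaussianPDFReal m₁ v y * gaussianPDFReal m₀ v x) : x = y := by
  have hv' : (0 : ℝ) < v := by positivity
  have hc : (√(2 * Real.pi * v))⁻¹ ≠ 0 := by positivity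
  simp only [gaussianPDFReal] at h
  have hexp : Real.exp (-(x - m₁) ^ 2 / (2 * v) + -(y - m₀) ^ 2 / (2 * v))
      = Real.exp (-(y - m₁) ^ 2 / (2 * v) + -(x - m₀) ^ 2 / (2 * v)) := by
    rw [Real.exp_add, Real.exp_add]
    apply mul_left_cancel₀ (mul_ne_zero hc hc)
    linear_combination h
  have hlin := Real.exp_injective hexp
  field_simp at hlin
  have : (x - y) * (m₁ - m₀) = 0 := by linear_combination hlin / 2
  exact sub_eq_zero.1 ((mul_eq_zero.1 this).resolve_right (sub_ne_zero.2 hm.symm))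

/-- **Conditioning on a collider induces dependence.**
`A` is `{0,1}`-valued (modelled as `Bool`-valued, `true = 1`) with `0 < P(A = 1) < 1`, the
conditional law of `X2` given `A = a` is `N(μ_a, σ_2²)` with `μ_0 ≠ μ_1`, and `X3` is
`N(0, σ_3²)` independent of the pair `(A, X2)`. For `Y = β₂·X2 + β₃·X3` with `β₂, β₃ ≠ 0`:
`X3` is independent of `A`, yet `X3` and `A` are NOT conditionally independent given the
collider `Y`. -/
theorem collider_conditioning_induces_dependence
    {Ω : Type*} [MeasurableSpace Ω] [StandardBorelSpace Ω] [Nonempty Ω]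
    (μ : Measure Ω) [IsProbabilityMeasure μ]
    (A : Ω → Bool) (hA : Measurable A)
    (hA1 : 0 < μ {ω | A ω = true}) (hA1' : μ {ω | A ω = true} < 1)
    (X2 : Ω → ℝ) (hX2 : Measurable X2)
    (μf : Bool → ℝ) (hμf : μf false ≠ μf true) (σ2 : ℝ) (hσ2 : 0 < σ2)
    (hX2law : ∀ a : Bool,
      (μ[|{ω | A ω = a}]).map X2 = gaussianReal (μf a) ((σ2 ^ 2).toNNReal))
    (X3 : Ω → ℝ) (hX3 : Measurable X3) (σ3 : ℝ) (hσ3 : 0 < σ3)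
    (hX3law : μ.map X3 = gaussianReal 0 ((σ3 ^ 2).toNNReal))
    (hX3indep : IndepFun X3 (fun ω => (A ω, X2 ω)) μ)
    (β₂ β₃ : ℝ) (hβ₂ : β₂ ≠ 0) (hβ₃ : β₃ ≠ 0)
    (Y : Ω → ℝ) (hY : Y = fun ω => β₂ * X2 ω + β₃ * X3 ω) (hYm : Measurable Y) :
    IndepFun X3 A μ
      ∧ ¬ CondIndepFun (MeasurableSpace.comap Y inferInstance) hYm.comap_le X3 A μ := by
  refine ⟨hX3indep.comp measurable_id measurable_fst, fun hCI ↦ ?_⟩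
  have hv₂ : (σ2 ^ 2).toNNReal ≠ 0 := (Real.toNNReal_pos.2 (by positivity)).ne'
  have hv₃ : (σ3 ^ 2).toNNReal ≠ 0 := (Real.toNNReal_pos.2 (by positivity)).ne'
  have hpos : ∀ a, μ (A ⁻¹' {a}) ≠ 0 := by
    rintro (_ | _)
    · rw [show A ⁻¹' {false} = {ω | A ω = true}ᶜ by ext ω; simp]
      exact fun h0 ↦ hA1'.ne ((prob_compl_eq_zero_iff (hA (measurableSet_singleton true))).1 h0)
    · exact hA1.ne'
  let c : Bool → ENNReal := fun a ↦ μ (A ⁻¹' {a})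
  let f : Bool → ℝ → ENNReal := fun a x ↦ c a * gaussianPDF (μf a) (σ2 ^ 2).toNNReal x
  let φ : ℝ → ENNReal := gaussianPDF 0 (σ3 ^ 2).toNNReal
  have hφ : Measurable φ := measurable_gaussianPDF _ _
  have hf : ∀ a, Measurable (f a) := fun a ↦ (measurable_gaussianPDF _ _).const_mul _
  have hX : Measurable fun ω ↦ (X2 ω, X3 ω) := hX2.prodMk hX3
  have hlaw₂ : ∀ a, (μ.restrict (A ⁻¹' {a})).map X2 = volume.withDensity (f a) := by
    intro a
    have h := hX2law a
    rw [show {ω | A ω = a} = A ⁻¹' {a} from rfl, ProbabilityTheory.cond, Measure.map_smul,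
      gaussianReal_of_var_ne_zero _ hv₂] at h
    rw [show f a = c a • gaussianPDF (μf a) (σ2 ^ 2).toNNReal from rfl,
      withDensity_smul _ (measurable_gaussianPDF _ _), ← h, smul_smul,
      ENNReal.mul_inv_cancel (hpos a) (measure_ne_top _ _), one_smul]
  have hlaw : ∀ a, (μ.restrict (A ⁻¹' {a})).map (fun ω ↦ (X2 ω, X3 ω))
      = volume.withDensity fun p : ℝ × ℝ ↦ f a p.1 * φ p.2 := by
    intro a
    rw [map_restrict_preimage_prodMk_eq_prod_of_indepFun hX2 hX3 hX3indep
      (measurableSet_singleton a), hlaw₂, hX3law, gaussianReal_of_var_ne_zero _ hv₃,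
      prod_withDensity (hf a) hφ, ← Measure.volume_eq_prod]
  have hfφ : ∀ a, Measurable fun p : ℝ × ℝ ↦ f a p.1 * φ p.2 := fun a ↦
    ((hf a).comp measurable_fst).mul (hφ.comp measurable_snd)
  have hlaw_joint : μ.map (fun ω ↦ (X2 ω, X3 ω))
      = volume.withDensity fun p : ℝ × ℝ ↦ f false p.1 * φ p.2 + f true p.1 * φ p.2 := by
    have hsplit : μ = μ.restrict (A ⁻¹' {false}) + μ.restrict (A ⁻¹' {true}) := by
      rw [show A ⁻¹' {true} = (A ⁻¹' {false})ᶜ by ext ω; simp,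
        Measure.restrict_add_restrict_compl (hA (measurableSet_singleton false))]
    conv_lhs => rw [hsplit]
    rw [Measure.map_add _ _ hX, hlaw, hlaw, ← withDensity_add_left (hfφ false)]
    rfl
  have hsum : Measurable fun p : ℝ × ℝ ↦ f false p.1 * φ p.2 + f true p.1 * φ p.2 :=
    (hfφ false).add (hfφ true)
  let h : ℝ → ENNReal := fun y ↦ condDistrib A Y μ y {true}
  have hh : Measurable h := Kernel.measurable_coe _ (measurableSet_singleton true)
  have hhL : Measurable fun p : ℝ × ℝ ↦ h (β₂ * p.1 + β₃ * p.2) := hh.comp (by fun_prop)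
  have hdens : (μ.restrict (A ⁻¹' {true})).map (fun ω ↦ (X2 ω, X3 ω))
      = (μ.map fun ω ↦ (X2 ω, X3 ω)).withDensity fun p ↦ h (β₂ * p.1 + β₃ * p.2) := by
    ext t ht
    have hmeas : Measurable fun q : ℝ × ℝ ↦ ((q.1 - β₃ * q.2) / β₂, q.2) := by fun_prop
    have hpre : (fun ω ↦ (Y ω, X3 ω)) ⁻¹' ((fun q : ℝ × ℝ ↦ ((q.1 - β₃ * q.2) / β₂, q.2)) ⁻¹' t)
        = (fun ω ↦ (X2 ω, X3 ω)) ⁻¹' t := by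
      ext ω
      simp [hY, hβ₂]
    have key := measure_preimage_inter_eq_setLIntegral_of_condIndepFun hA hX3 hYm hCI
      (measurableSet_singleton true) (hmeas ht)
    rw [hpre] at key
    rw [Measure.map_apply hX ht, Measure.restrict_apply (hX ht), key, withDensity_apply _ ht,
      setLIntegral_map ht hhL hX]
    simp only [h, hY]
  rw [hlaw, hlaw_joint, ← withDensity_mul _ hsum hhL,
    withDensity_eq_iff_of_sigmaFinite (hfφ true).aemeasurable
      (hsum.mul hhL).aemeasurable] at hdens
  have hrel : ∀ᵐ p : ℝ × ℝ, f true p.1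
      = (f false p.1 + f true p.1) * h (β₂ * p.1 + β₃ * p.2) := by
    filter_upwards [hdens] with p hp
    simp only [Pi.mul_apply, ← add_mul] at hp
    exact (ENNReal.mul_left_inj (gaussianPDF_pos _ hv₃ _).ne' gaussianPDF_ne_top).1
      (hp.trans (mul_right_comm _ _ _))
  obtain ⟨x, x', u, hne, hx, hx'⟩ := exists_ne_of_ae_prod_affine
    (S := fun x u ↦ f true x = (f false x + f true x) * h u) hβ₃ hrel
  have hcross : f true x * f false x' = f true x' * f false x := by
    have hfin : f true x * f true x' ≠ ⊤ := by
      have hf_top : ∀ y, f true y ≠ ⊤ := fun _ ↦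
        ENNReal.mul_ne_top (measure_ne_top _ _) gaussianPDF_ne_top
      exact ENNReal.mul_ne_top (hf_top x) (hf_top x')
    refine (ENNReal.add_left_inj hfin).1 ?_
    calc f true x * f false x' + f true x * f true x'
        = (f false x + f true x) * ((f false x' + f true x') * h u) := by
          rw [← mul_add]; nth_rw 1 [hx]; ring
      _ = f true x' * f false x + f true x * f true x' := by rw [← hx']; ring
  refine hne (eq_of_gaussianPDFReal_mul_eq hμf hv₂ ?_)
  have hc : ∀ a, (c a).toReal ≠ 0 := fun a ↦
    ENNReal.toReal_ne_zero.2 ⟨hpos a, measure_ne_top _ _⟩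
  have hreal := congrArg ENNReal.toReal hcross
  simp only [f, ENNReal.toReal_mul, toReal_gaussianPDF] at hreal
  apply mul_left_cancel₀ (mul_ne_zero (hc true) (hc false))
  linear_combination hreal
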